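/- arXiv:1510.02714 — 2 statements merged into one kernel-verified Lean document; each statement's English description precedes it below -/
import Mathlib

section
/- Let R be a commutative noetherian domain and let f : C → D be an injective homomorphism of flat R-coalgebras. Then for every right C-comodule (M, ρ) (not necessarily torsion-free) and every R-submodule N ⊆ M with M/N R-torsion-free which is a D-subcomodule via f, the submodule N is C-stable: ρ(N) is contained in the image of N ⊗ C in M ⊗ C. -/
open TensorProduct LinearMap

/-- The localization of a torsion-free module over a domain at the nonzero elements is flat, and
the module embeds in it. -/
theorem flat_localizedModule_and_mkLinearMap_injective (R Q : Type*) [CommRing R] [IsDomain R]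
    [AddCommGroup Q] [Module R Q] [NoZeroSMulDivisors R Q] :
    Module.Flat R (LocalizedModule (nonZeroDivisors R) Q) ∧
      Function.Injective (LocalizedModule.mkLinearMap (nonZeroDivisors R) Q) := by
  constructor
  · let _ : Module (FractionRing R) (LocalizedModule (nonZeroDivisors R) Q) :=
      inferInstanceAs (Module (Localization (nonZeroDivisors R)) _)
    have : IsScalarTower R (FractionRing R) (LocalizedModule (nonZeroDivisors R) Q) :=
      inferInstanceAs (IsScalarTower R (Localization (nonZeroDivisors R)) _)
    have : Module.Flat R (FractionRing R) := IsLocalization.flat _ (nonZeroDivisors R)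
    exact Module.Flat.trans R (FractionRing R) _
  · rw [injective_iff_map_eq_zero]
    intro q hq
    obtain ⟨c, hc⟩ := (IsLocalizedModule.eq_zero_iff (nonZeroDivisors R) _).1 hq
    exact (smul_eq_zero.1 hc).resolve_left (nonZeroDivisors.coe_ne_zero c)

/-- Over a domain, tensoring with a torsion-free module preserves injectivity of linear maps whose
source is flat. -/
theorem lTensor_injective_of_noZeroSMulDivisors {R : Type*} (Q : Type*) {C D : Type*}
    [CommRing R] [IsDomain R] [AddCommGroup Q] [Module R Q] [NoZeroSMulDivisors R Q]
    [AddCommGroup C] [Module R C] [Module.Flat R C] [AddCommGroup D] [Module R D]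
    (f : C →ₗ[R] D) (hf : Function.Injective f) : Function.Injective (lTensor Q f) := by
  obtain ⟨hflat, hinj⟩ := flat_localizedModule_and_mkLinearMap_injective R Q
  set i := LocalizedModule.mkLinearMap (nonZeroDivisors R) Q
  have hcomp : Function.Injective (lTensor _ f ∘ₗ rTensor C i) :=
    (Module.Flat.lTensor_preserves_injective_linearMap f hf).comp
      (Module.Flat.rTensor_preserves_injective_linearMap i hinj)
  rw [lTensor_comp_rTensor, ← rTensor_comp_lTensor, coe_comp] at hcomp
  exact hcomp.of_comp

/-- **Proposition 9b (1), complement.** Let `R` be a commutative noetherian domain and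
`f : C → D` an injective homomorphism of flat `R`-coalgebras.  Then for every right
`C`-comodule `(M, ρ)` (not necessarily torsion-free) and every `R`-submodule `N ⊆ M`
with `M/N` torsion-free which is a `D`-subcomodule via `f`, the submodule `N` is
`C`-stable. -/
theorem statement15 (R C D : Type) [CommRing R] [IsDomain R] [IsNoetherianRing R]
    [AddCommGroup C] [Module R C] [Coalgebra R C] [Module.Flat R C]
    [AddCommGroup D] [Module R D] [Coalgebra R D] [Module.Flat R D]
    (f : C →ₗc[R] D) (hf : Function.Injective f) :
    ∀ (M : Type) [AddCommGroup M] [Module R M],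
      ∀ ρ : M →ₗ[R] M ⊗[R] C,
        (∀ m : M, (TensorProduct.assoc R M C C) ((rTensor C ρ) (ρ m)) =
            (lTensor M (Coalgebra.comul : C →ₗ[R] C ⊗[R] C)) (ρ m)) →
        (∀ m : M, (TensorProduct.rid R M)
            ((lTensor M (Coalgebra.counit : C →ₗ[R] R)) (ρ m)) = m) →
        ∀ N : Submodule R M, NoZeroSMulDivisors R (M ⧸ N) →
          (∀ n ∈ N, (lTensor M f.toLinearMap) (ρ n) ∈
              LinearMap.range (TensorProduct.map N.subtype (LinearMap.id : D →ₗ[R] D))) →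
          ∀ n ∈ N, ρ n ∈
            LinearMap.range (TensorProduct.map N.subtype (LinearMap.id : C →ₗ[R] C)) := by
  intro M _ _ ρ _ _ N _ hN n hn
  have hD := rTensor_exact D (exact_subtype_mkQ N) N.mkQ_surjective
  have hC := rTensor_exact C (exact_subtype_mkQ N) N.mkQ_surjective
  refine (hC _).1 (lTensor_injective_of_noZeroSMulDivisors (M ⧸ N) f.toLinearMap hf ?_)
  rw [map_zero, ← comp_apply, lTensor_comp_rTensor, ← rTensor_comp_lTensor, comp_apply]
  exact (hD _).2 (hN n hn)
end

section
/- Let R be a commutative noetherian domain and let f : C → D be a homomorphism of flat R-coalgebras. Then f is injective and pure (i.e. injective with D/f(C) a flat R-module) if and only if for every right C-comodule (M, ρ) and every R-submodule N ⊆ M which is a D-subcomodule via f (i.e. (id_M ⊗ f)∘ρ maps N into the image of N ⊗ D in M ⊗ D), the submodule N is C-stable (i.e. ρ(N) is contained in the image of N ⊗ C in M ⊗ C). -/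
open TensorProduct LinearMap

universe u

/-- In an exact sequence `C → D → Q → 0` with `D` flat, if `C → D` stays injective after tensoring
with every module, then `Q` is flat. -/
lemma Module.Flat.of_exact_of_lTensor_injective {R : Type u} {C D Q : Type*} [CommRing R]
    [AddCommGroup C] [Module R C] [AddCommGroup D] [Module R D] [AddCommGroup Q] [Module R Q]
    [Module.Flat R D] {g : C →ₗ[R] D} {p : D →ₗ[R] Q} (hgp : Function.Exact g p)
    (hp : Function.Surjective p)
    (h : ∀ (A : Type u) [AddCommGroup A] [Module R A], Function.Injective (g.lTensor A)) :
    Module.Flat R Q := by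
  rw [Module.Flat.iff_rTensor_preserves_injective_linearMap'.{u}]
  intro N P _ _ _ _ i hi
  rw [injective_iff_map_eq_zero]
  intro x hx
  obtain ⟨y, rfl⟩ := lTensor_surjective N hp x
  have hy : p.lTensor P (i.rTensor D y) = 0 := by
    rw [← hx, ← comp_apply, ← comp_apply, lTensor_comp_rTensor, rTensor_comp_lTensor]
  obtain ⟨c, hc⟩ := (_root_.lTensor_exact P hgp hp _).1 hy
  let π := (range i).mkQ
  have hiπ : Function.Exact i π := exact_map_mkQ_range i
  have hπ : Function.Surjective π := Submodule.mkQ_surjective _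
  have hc' : π.rTensor C c = 0 := by
    apply h (P ⧸ range i)
    rw [map_zero, ← comp_apply, lTensor_comp_rTensor, ← rTensor_comp_lTensor, comp_apply, hc]
    exact (_root_.rTensor_exact D hiπ hπ _).2 ⟨y, rfl⟩
  obtain ⟨z, rfl⟩ := (_root_.rTensor_exact C hiπ hπ _).1 hc'
  have hzy : g.lTensor N z = y := by
    apply Module.Flat.rTensor_preserves_injective_linearMap (M := D) i hi
    rw [← hc, ← comp_apply, ← comp_apply, lTensor_comp_rTensor, rTensor_comp_lTensor]
  exact (_root_.lTensor_exact N hgp hp _).2 ⟨z, hzy⟩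

/-- If `f` is injective after tensoring with `M ⧸ N`, then membership in the image of `N ⊗ C` can be
tested after applying `f`. -/
lemma TensorProduct.mem_range_map_subtype_of_lTensor_mem {R M C D : Type*} [CommRing R]
    [AddCommGroup M] [Module R M] [AddCommGroup C] [Module R C] [AddCommGroup D] [Module R D]
    {f : C →ₗ[R] D} {N : Submodule R M} (hf : Function.Injective (f.lTensor (M ⧸ N)))
    {x : M ⊗[R] C} (hx : f.lTensor M x ∈ range (TensorProduct.map N.subtype LinearMap.id)) :
    x ∈ range (TensorProduct.map N.subtype LinearMap.id) := by
  have hN : Function.Exact N.subtype N.mkQ := exact_subtype_mkQ N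
  apply (rTensor_exact C hN N.mkQ_surjective x).1
  apply hf
  rw [map_zero, ← comp_apply, lTensor_comp_rTensor, ← rTensor_comp_lTensor, comp_apply]
  exact (rTensor_exact D hN N.mkQ_surjective _).2 hx

section CofreeComodule

variable (R : Type*) [CommRing R] (A : Type*) [AddCommGroup A] [Module R A]
  (C : Type*) [AddCommGroup C] [Module R C] [Coalgebra R C]

/-- The coaction of the cofree right `C`-comodule `A ⊗ C`. -/
noncomputable def cofreeCoaction : A ⊗[R] C →ₗ[R] (A ⊗[R] C) ⊗[R] C :=
  (TensorProduct.assoc R A C C).symm.toLinearMap ∘ₗ lTensor A Coalgebra.comul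

variable {R A C}

lemma cofreeCoaction_coassoc (m : A ⊗[R] C) :
    TensorProduct.assoc R (A ⊗[R] C) C C
        (rTensor C (cofreeCoaction R A C) (cofreeCoaction R A C m)) =
      lTensor (A ⊗[R] C) (Coalgebra.comul : C →ₗ[R] C ⊗[R] C) (cofreeCoaction R A C m) := by
  induction m with
  | zero => simp
  | add x y hx hy => simp only [map_add, hx, hy]
  | tmul a c =>
    have h₁ : ∀ z : C ⊗[R] C, TensorProduct.assoc R (A ⊗[R] C) C C
        (rTensor C (cofreeCoaction R A C) ((TensorProduct.assoc R A C C).symm (a ⊗ₜ z))) =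
        (TensorProduct.assoc R A C (C ⊗[R] C)).symm
          (a ⊗ₜ TensorProduct.assoc R C C C (rTensor C Coalgebra.comul z)) := by
      intro z
      induction z with
      | zero => simp
      | add x y hx hy => simp only [map_add, tmul_add, hx, hy]
      | tmul b d =>
        simp only [assoc_symm_tmul, rTensor_tmul, cofreeCoaction, comp_apply, lTensor_tmul,
          LinearEquiv.coe_coe]
        induction (Coalgebra.comul b : C ⊗[R] C) with
        | zero => simp
        | add x y hx hy => simp only [map_add, tmul_add, add_tmul, hx, hy]
        | tmul _ _ => simp
    have h₂ : ∀ z : C ⊗[R] C, lTensor (A ⊗[R] C) (Coalgebra.comul : C →ₗ[R] C ⊗[R] C)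
        ((TensorProduct.assoc R A C C).symm (a ⊗ₜ z)) =
        (TensorProduct.assoc R A C (C ⊗[R] C)).symm (a ⊗ₜ lTensor C Coalgebra.comul z) := by
      intro z
      induction z with
      | zero => simp
      | add x y hx hy => simp only [map_add, tmul_add, hx, hy]
      | tmul b d => simp
    have h₀ : cofreeCoaction R A C (a ⊗ₜ c) =
        (TensorProduct.assoc R A C C).symm (a ⊗ₜ Coalgebra.comul c) := rfl
    rw [h₀, h₁, h₂, Coalgebra.coassoc_apply]

lemma cofreeCoaction_counit (m : A ⊗[R] C) :
    TensorProduct.rid R (A ⊗[R] C)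
      (lTensor (A ⊗[R] C) (Coalgebra.counit : C →ₗ[R] R) (cofreeCoaction R A C m)) = m := by
  induction m with
  | zero => simp
  | add x y hx hy => simp only [map_add, hx, hy]
  | tmul a c =>
    have h : ∀ z : C ⊗[R] C, TensorProduct.rid R (A ⊗[R] C)
        (lTensor (A ⊗[R] C) (Coalgebra.counit : C →ₗ[R] R)
          ((TensorProduct.assoc R A C C).symm (a ⊗ₜ z))) =
        a ⊗ₜ TensorProduct.rid R C (lTensor C Coalgebra.counit z) := by
      intro z
      induction z with
      | zero => simp
      | add x y hx hy => simp only [map_add, tmul_add, hx, hy]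
      | tmul b d => simp
    exact (h _).trans (by simp)

lemma rTensor_counit_cofreeCoaction (m : A ⊗[R] C) :
    rTensor C ((TensorProduct.rid R A).toLinearMap ∘ₗ lTensor A Coalgebra.counit)
      (cofreeCoaction R A C m) = m := by
  induction m with
  | zero => simp
  | add x y hx hy => simp only [map_add, hx, hy]
  | tmul a c =>
    have h : ∀ z : C ⊗[R] C,
        rTensor C ((TensorProduct.rid R A).toLinearMap ∘ₗ lTensor A Coalgebra.counit)
          ((TensorProduct.assoc R A C C).symm (a ⊗ₜ z)) =
        a ⊗ₜ TensorProduct.lid R C (rTensor C Coalgebra.counit z) := by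
      intro z
      induction z with
      | zero => simp
      | add x y hx hy => simp only [map_add, tmul_add, hx, hy]
      | tmul b d => simp [smul_tmul]
    exact (h _).trans (by simp)

variable {D : Type*} [AddCommGroup D] [Module R D] [Coalgebra R D]

lemma map_cofreeCoaction (f : C →ₗc[R] D) (m : A ⊗[R] C) :
    TensorProduct.map (lTensor A f.toLinearMap) f.toLinearMap (cofreeCoaction R A C m) =
      cofreeCoaction R A D (lTensor A f.toLinearMap m) := by
  induction m with
  | zero => simp
  | add x y hx hy => simp only [map_add, hx, hy]
  | tmul a c =>
    have h : ∀ z : C ⊗[R] C, TensorProduct.map (lTensor A f.toLinearMap) f.toLinearMap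
          ((TensorProduct.assoc R A C C).symm (a ⊗ₜ z)) =
        (TensorProduct.assoc R A D D).symm
          (a ⊗ₜ TensorProduct.map f.toLinearMap f.toLinearMap z) := by
      intro z
      induction z with
      | zero => simp
      | add x y hx hy => simp only [map_add, tmul_add, hx, hy]
      | tmul b d => simp
    exact (h _).trans (congrArg (fun z ↦ (TensorProduct.assoc R A D D).symm (a ⊗ₜ z))
      (CoalgHomClass.map_comp_comul_apply f c))

/-- The kernel of `A ⊗ C → A ⊗ D` is a `D`-subcomodule of the cofree comodule `A ⊗ C`. -/
lemma lTensor_cofreeCoaction_mem_of_mem_ker [Module.Flat R D] (f : C →ₗc[R] D) {m : A ⊗[R] C}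
    (hm : m ∈ ker (lTensor A f.toLinearMap)) :
    lTensor (A ⊗[R] C) f.toLinearMap (cofreeCoaction R A C m) ∈
      range (TensorProduct.map (ker (lTensor A f.toLinearMap)).subtype
        (LinearMap.id : D →ₗ[R] D)) := by
  apply (Module.Flat.rTensor_exact D (exact_subtype_ker_map (lTensor A f.toLinearMap)) _).1
  rw [← comp_apply, rTensor_comp_lTensor, map_cofreeCoaction, mem_ker.1 hm, map_zero]

/-- If the kernel of `A ⊗ C → A ⊗ D` is a `C`-subcomodule, then it vanishes, since it is killed by
`A ⊗ ε`. -/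
lemma lTensor_injective_of_ker_stable (f : C →ₗc[R] D)
    (h : ∀ m ∈ ker (lTensor A f.toLinearMap), cofreeCoaction R A C m ∈
      range (TensorProduct.map (ker (lTensor A f.toLinearMap)).subtype
        (LinearMap.id : C →ₗ[R] C))) :
    Function.Injective (lTensor A f.toLinearMap) := by
  rw [injective_iff_map_eq_zero]
  intro m hm
  obtain ⟨t, ht⟩ := h m hm
  have hε : ((TensorProduct.rid R A).toLinearMap ∘ₗ lTensor A Coalgebra.counit) ∘ₗ
      (ker (lTensor A f.toLinearMap)).subtype = 0 := by
    have hf : (Coalgebra.counit : D →ₗ[R] R) ∘ₗ f.toLinearMap = Coalgebra.counit := f.counit_comp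
    rw [← hf, lTensor_comp]
    refine LinearMap.ext fun x ↦ ?_
    change TensorProduct.rid R A (lTensor A Coalgebra.counit (lTensor A f.toLinearMap x)) = 0
    rw [mem_ker.1 x.2, map_zero, map_zero]
  rw [← rTensor_counit_cofreeCoaction m, ← ht]
  change rTensor C _ (rTensor C _ t) = 0
  rw [← rTensor_comp_apply, hε, rTensor_zero, LinearMap.zero_apply]

end CofreeComodule

/-- **Proposition 9b (2).** Let `R` be a commutative noetherian domain and `f : C → D`
a homomorphism of flat `R`-coalgebras.  Then `f` is injective and pure (i.e. injective
with `D/f(C)` a flat `R`-module) iff for every right `C`-comodule `(M, ρ)` and every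
`R`-submodule `N ⊆ M` which is a `D`-subcomodule via `f`, the submodule `N` is
`C`-stable. -/
theorem statement17 (R C D : Type) [CommRing R] [IsDomain R] [IsNoetherianRing R]
    [AddCommGroup C] [Module R C] [Coalgebra R C] [Module.Flat R C]
    [AddCommGroup D] [Module R D] [Coalgebra R D] [Module.Flat R D]
    (f : C →ₗc[R] D) :
    (Function.Injective f ∧ Module.Flat R (D ⧸ LinearMap.range f.toLinearMap)) ↔
      ∀ (M : Type) [AddCommGroup M] [Module R M],
        ∀ ρ : M →ₗ[R] M ⊗[R] C,
          (∀ m : M, (TensorProduct.assoc R M C C) ((rTensor C ρ) (ρ m)) =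
              (lTensor M (Coalgebra.comul : C →ₗ[R] C ⊗[R] C)) (ρ m)) →
          (∀ m : M, (TensorProduct.rid R M)
              ((lTensor M (Coalgebra.counit : C →ₗ[R] R)) (ρ m)) = m) →
          ∀ N : Submodule R M,
            (∀ n ∈ N, (lTensor M f.toLinearMap) (ρ n) ∈
                LinearMap.range (TensorProduct.map N.subtype (LinearMap.id : D →ₗ[R] D))) →
            ∀ n ∈ N, ρ n ∈
              LinearMap.range (TensorProduct.map N.subtype (LinearMap.id : C →ₗ[R] C)) := by
  constructor
  · rintro ⟨hf, hflat⟩ M _ _ ρ - - N hN n hn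
    exact TensorProduct.mem_range_map_subtype_of_lTensor_mem
      (lTensor_injective_of_exact_of_flat _ (Submodule.mkQ_surjective _) f.toLinearMap hf
        (exact_map_mkQ_range _) _) (hN n hn)
  · intro h
    have hA (A : Type) [AddCommGroup A] [Module R A] :
        Function.Injective (lTensor A f.toLinearMap) :=
      lTensor_injective_of_ker_stable f <| h (A ⊗[R] C) (cofreeCoaction R A C)
        cofreeCoaction_coassoc cofreeCoaction_counit _
        fun _ ↦ lTensor_cofreeCoaction_mem_of_mem_ker f
    refine ⟨fun x y hxy ↦ ?_, .of_exact_of_lTensor_injective (exact_map_mkQ_range _)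
      (Submodule.mkQ_surjective _) hA⟩
    apply (TensorProduct.lid R C).symm.injective
    apply hA R
    simp [hxy]
end
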